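/- With the notation of the block-embedding (step graphon 𝒦 of K ∈ ℝ^{n×n}, step function 𝓀 of k ∈ ℝⁿ), for every R > 0 the constrained minima agree: min over v ∈ ℝⁿ with ‖v‖_∞ ≤ R of (1/n)‖(1/n)Kv − k‖₂² + (λ/n²)⟨v, Kv⟩ equals the infimum over measurable f : [0,1] → ℝ with ‖f‖_∞ ≤ R of ‖𝒦f − 𝓀‖₂² + λ⟨f, 𝒦f⟩. -/

import Mathlib

open MeasureTheory Matrix

noncomputable def binIdx (n : ℕ) (x : ℝ) : ℕ := min (n - 1) (⌈x * n⌉₊ - 1)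


noncomputable def bIdx (n : ℕ) (hn : 1 ≤ n) (x : ℝ) : Fin n :=
  ⟨binIdx n x, by unfold binIdx; omega⟩

lemma measurable_binIdx (n : ℕ) : Measurable (binIdx n) := by
  have h : Measurable (fun x : ℝ => ⌈x * n⌉₊) :=
    Nat.measurable_ceil.comp (measurable_id.mul_const _)
  exact (measurable_from_nat (f := fun m : ℕ => min (n - 1) (m - 1))).comp h

lemma measurableSet_blk (n : ℕ) (hn : 0 < n) (i : Fin n) :
    MeasurableSet {x | bIdx n hn x = i} := by
  have : {x | bIdx n hn x = i} = binIdx n ⁻¹' {(i : ℕ)} := by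
    ext x; simp [bIdx, Fin.ext_iff]
  rw [this]
  exact measurable_binIdx n (measurableSet_singleton _)

lemma measurable_bIdx (n : ℕ) (hn : 0 < n) : Measurable (bIdx n hn) :=
  measurable_to_countable' fun i => measurableSet_blk n hn i

lemma blk_eq (n : ℕ) (hn : 0 < n) (i : Fin n) :
    {x | bIdx n hn x = i} ∩ Set.Ioc (0:ℝ) 1 = Set.Ioc ((i:ℝ) / n) (((i:ℝ) + 1) / n) := by
  have hn' : (0:ℝ) < n := by exact_mod_cast hn
  have hi : (i:ℕ) < n := i.2
  have hi' : ((i:ℕ):ℝ) + 1 ≤ n := by exact_mod_cast hi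
  ext x
  simp only [Set.mem_inter_iff, Set.mem_setOf_eq, Set.mem_Ioc, bIdx, Fin.ext_iff, binIdx]
  rw [div_lt_iff₀ hn', le_div_iff₀ hn']
  constructor
  · rintro ⟨h, h0, h1⟩
    have hc : 0 < ⌈x * n⌉₊ := Nat.ceil_pos.2 (by positivity)
    have hc2 : ⌈x * n⌉₊ ≤ n := Nat.ceil_le.2 (by nlinarith)
    have he : ⌈x * n⌉₊ = (i:ℕ) + 1 := by omega
    constructor
    · apply Nat.lt_ceil.1; omega
    · have := Nat.le_ceil (x * n)
      rw [he] at this; exact_mod_cast this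
  · rintro ⟨h0, h1⟩
    have he1 : (i:ℕ) < ⌈x * n⌉₊ := Nat.lt_ceil.2 h0
    have he2 : ⌈x * n⌉₊ ≤ (i:ℕ) + 1 := Nat.ceil_le.2 (by exact_mod_cast h1)
    refine ⟨by omega, ?_, ?_⟩
    · by_contra hx
      have : (0:ℝ) ≤ i := by positivity
      nlinarith
    · by_contra hx
      nlinarith

lemma int_blk (n : ℕ) (hn : 0 < n) (i : Fin n) :
    ∫ y in Set.Icc (0:ℝ) 1, {x | bIdx n hn x = i}.indicator (fun _ => (1:ℝ)) y = 1 / n := by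
  have hn' : (0:ℝ) < n := by exact_mod_cast hn
  rw [integral_Icc_eq_integral_Ioc, integral_indicator (measurableSet_blk n hn i),
    Measure.restrict_restrict (measurableSet_blk n hn i), blk_eq]
  have : (i:ℝ) / n ≤ ((i:ℝ) + 1) / n := by gcongr; linarith
  simp [Measure.real, Real.volume_Ioc]
  rw [ENNReal.toReal_ofReal (by linarith)]
  field_simp; ring

noncomputable def bAvg (n : ℕ) (hn : 0 < n) (f : ℝ → ℝ) (i : Fin n) : ℝ :=
  n * ∫ y in Set.Icc (0:ℝ) 1, {x | bIdx n hn x = i}.indicator f y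

lemma int_step_mul (n : ℕ) (hn : 0 < n) (g : Fin n → ℝ) (f : ℝ → ℝ)
    (hf : IntegrableOn f (Set.Icc (0:ℝ) 1)) :
    ∫ y in Set.Icc (0:ℝ) 1, g (bIdx n hn y) * f y = (1 / n) * ∑ i, g i * bAvg n hn f i := by
  have hn' : (n:ℝ) ≠ 0 := by positivity
  have h1 : ∀ y, g (bIdx n hn y) * f y
      = ∑ i, g i * {x | bIdx n hn x = i}.indicator f y := by
    intro y
    simp [Set.indicator_apply]
  simp_rw [h1]
  rw [integral_finset_sum]
  · rw [Finset.mul_sum]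
    refine Finset.sum_congr rfl fun i _ => ?_
    rw [integral_const_mul, bAvg]
    field_simp
  · intro i _
    exact (Integrable.indicator hf (measurableSet_blk n hn i)).const_mul _

lemma bAvg_one (n : ℕ) (hn : 0 < n) (i : Fin n) : bAvg n hn (fun _ => 1) i = 1 := by
  have hn' : (n:ℝ) ≠ 0 := by positivity
  rw [bAvg, int_blk]; field_simp

lemma int_step (n : ℕ) (hn : 0 < n) (g : Fin n → ℝ) :
    ∫ y in Set.Icc (0:ℝ) 1, g (bIdx n hn y) = (1 / n) * ∑ i, g i := by
  have := int_step_mul n hn g (fun _ => 1) (by simp)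
  simpa only [bAvg_one, mul_one] using this

lemma integrableOn_bdd {f : ℝ → ℝ} {R : ℝ} (hf : Measurable f) (h : ∀ x, |f x| ≤ R) :
    IntegrableOn f (Set.Icc (0:ℝ) 1) := by
  refine Integrable.of_bound hf.aestronglyMeasurable R (Filter.Eventually.of_forall ?_)
  simpa using h

lemma bAvg_le (n : ℕ) (hn : 0 < n) {f : ℝ → ℝ} {R : ℝ} (h : ∀ x, |f x| ≤ R) (i : Fin n) :
    |bAvg n hn f i| ≤ R := by
  have hn' : (0:ℝ) < n := by exact_mod_cast hn
  have key : ‖∫ y in Set.Icc (0:ℝ) 1, {x | bIdx n hn x = i}.indicator f y‖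
      ≤ ∫ y in Set.Icc (0:ℝ) 1, R * {x | bIdx n hn x = i}.indicator (fun _ => (1:ℝ)) y := by
    apply norm_integral_le_of_norm_le
    · apply Integrable.const_mul
      exact Integrable.indicator (by simp) (measurableSet_blk n hn i)
    · refine Filter.Eventually.of_forall fun y => ?_
      by_cases hy : bIdx n hn y = i
      · simpa [Set.indicator_apply, hy] using h y
      · simp [Set.indicator_apply, hy]
  rw [integral_const_mul, int_blk, Real.norm_eq_abs] at key
  rw [bAvg, abs_mul, abs_of_pos hn']
  calc _ ≤ (n:ℝ) * (R * (1 / n)) := by gcongr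
    _ = R := by field_simp

lemma bAvg_step (n : ℕ) (hn : 0 < n) (v : Fin n → ℝ) :
    bAvg n hn (fun x => v (bIdx n hn x)) = v := by
  have hn' : (n:ℝ) ≠ 0 := by positivity
  ext i
  have : ∀ y, {x | bIdx n hn x = i}.indicator (fun x => v (bIdx n hn x)) y
      = v i * {x | bIdx n hn x = i}.indicator (fun _ => (1:ℝ)) y := by
    intro y
    by_cases hy : bIdx n hn y = i <;> simp [Set.indicator_apply, hy]
  rw [bAvg]
  simp_rw [this]
  rw [integral_const_mul, int_blk]
  field_simp

theorem constrained_minima_agree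
    (n : ℕ) (hn : 0 < n)
    (K : Matrix (Fin n) (Fin n) ℝ) (hKsymm : K.IsSymm) (hKpsd : K.PosSemidef)
    (k : Fin n → ℝ) (lam : ℝ) (hlam : 0 < lam) (R : ℝ) (hR : 0 < R)
    (𝒦 : ℝ → ℝ → ℝ)
    (h𝒦 : ∀ x y, 𝒦 x y = K ⟨binIdx n x, by unfold binIdx; omega⟩ ⟨binIdx n y, by unfold binIdx; omega⟩)
    (𝓀 : ℝ → ℝ) (h𝓀 : ∀ x, 𝓀 x = k ⟨binIdx n x, by unfold binIdx; omega⟩) :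
    sInf ((fun v : Fin n → ℝ =>
        (1 / n) * (((1 / (n:ℝ)) • K.mulVec v - k) ⬝ᵥ ((1 / (n:ℝ)) • K.mulVec v - k))
          + (lam / n ^ 2) * (v ⬝ᵥ K.mulVec v)) '' {v | ∀ i, |v i| ≤ R})
    = sInf ((fun f : ℝ → ℝ =>
        (∫ x in Set.Icc (0:ℝ) 1, ((∫ y in Set.Icc (0:ℝ) 1, 𝒦 x y * f y) - 𝓀 x) ^ 2)
          + lam * ∫ x in Set.Icc (0:ℝ) 1, ∫ y in Set.Icc (0:ℝ) 1, f x * 𝒦 x y * f y) ''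
        {f | Measurable f ∧ ∀ x, |f x| ≤ R}) := by
  have hn' : (n:ℝ) ≠ 0 := by positivity
  have h𝒦' : ∀ x y, 𝒦 x y = K (bIdx n hn x) (bIdx n hn y) := h𝒦
  have h𝓀' : ∀ x, 𝓀 x = k (bIdx n hn x) := h𝓀
  have key : ∀ f : ℝ → ℝ, Measurable f → (∀ x, |f x| ≤ R) →
      (∫ x in Set.Icc (0:ℝ) 1, ((∫ y in Set.Icc (0:ℝ) 1, 𝒦 x y * f y) - 𝓀 x) ^ 2)
          + lam * ∫ x in Set.Icc (0:ℝ) 1, ∫ y in Set.Icc (0:ℝ) 1, f x * 𝒦 x y * f y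
      = (1 / n) * (((1 / (n:ℝ)) • K.mulVec (bAvg n hn f) - k) ⬝ᵥ
          ((1 / (n:ℝ)) • K.mulVec (bAvg n hn f) - k))
          + (lam / n ^ 2) * (bAvg n hn f ⬝ᵥ K.mulVec (bAvg n hn f)) := by
    intro f hf hb
    have hi := integrableOn_bdd hf hb
    have h1 : ∀ x, ∫ y in Set.Icc (0:ℝ) 1, 𝒦 x y * f y
        = (1 / n) * K.mulVec (bAvg n hn f) (bIdx n hn x) := by
      intro x
      simp_rw [h𝒦']
      exact int_step_mul n hn (fun j => K (bIdx n hn x) j) f hi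
    have h2 : ∀ x, ∫ y in Set.Icc (0:ℝ) 1, f x * 𝒦 x y * f y
        = ((1 / n) * K.mulVec (bAvg n hn f) (bIdx n hn x)) * f x := by
      intro x
      simp_rw [mul_assoc (f x)]
      rw [integral_const_mul, h1, mul_comm]
    simp_rw [h2, h1, h𝓀']
    rw [int_step n hn (fun i => ((1 / n) * K.mulVec (bAvg n hn f) i - k i) ^ 2),
      int_step_mul n hn (fun i => (1 / n) * K.mulVec (bAvg n hn f) i) f hi]
    congr 1
    · simp [dotProduct, pow_two]
    · simp only [dotProduct, Finset.mul_sum]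
      refine Finset.sum_congr rfl fun i _ => ?_
      field_simp
  congr 1
  ext t
  constructor
  · rintro ⟨v, hv, rfl⟩
    have hm : Measurable (fun x => v (bIdx n hn x)) :=
      (measurable_of_countable v).comp (measurable_bIdx n hn)
    refine ⟨fun x => v (bIdx n hn x), ⟨hm, fun x => hv _⟩, ?_⟩
    have := key _ hm (fun x => hv _)
    rw [bAvg_step] at this
    exact this
  · rintro ⟨f, ⟨hf, hb⟩, rfl⟩
    exact ⟨bAvg n hn f, fun i => bAvg_le n hn hb i, (key f hf hb).symm⟩
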